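/- Let 1 < j ≤ 2, m_j > 0 and δ > 0. Let f : ℝ → ℝ be differentiable with |f'(s) − f'(t)| ≤ m_j |s − t|^{j−1} for all s, t ∈ ℝ, and let f_δ : ℝ → ℝ satisfy ‖f_δ − f‖∞ ≤ δ. Set h_j = (δ / (m_j (j − 1)))^{1/j} and c_j = j (j − 1)^{−(j−1)/j} m_j^{1/j}. Then for every x ∈ ℝ, |(f_δ(x + h_j) − f_δ(x − h_j))/(2h_j) − f'(x)| ≤ c_j δ^{(j−1)/j}. -/

import Mathlib

/-- stable differentiation in the Hölder class `j ∈ (1,2]` with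
the optimal stepsize `h_j = (δ/(m_j(j-1)))^{1/j}` yields the error bound
`c_j δ^{(j-1)/j}` with `c_j = j (j-1)^{-(j-1)/j} m_j^{1/j}`. -/
theorem stable_differentiation_holder_bound
    (j mj δ : ℝ) (hj : 1 < j) (hj' : j ≤ 2) (hmj : 0 < mj) (hδ : 0 < δ)
    (f fδ : ℝ → ℝ)
    (hf : Differentiable ℝ f)
    (hfholder : ∀ s t : ℝ, |deriv f s - deriv f t| ≤ mj * |s - t| ^ (j - 1))
    (hfδ : ∀ x : ℝ, |fδ x - f x| ≤ δ)
    (hjδ cj : ℝ)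
    (hhj : hjδ = (δ / (mj * (j - 1))) ^ (1 / j))
    (hcj : cj = j * (j - 1) ^ (-((j - 1) / j)) * mj ^ (1 / j)) :
    ∀ x : ℝ,
      |(fδ (x + hjδ) - fδ (x - hjδ)) / (2 * hjδ) - deriv f x| ≤ cj * δ ^ ((j - 1) / j) := by
  intro x
  have hj0 : 0 < j := by linarith
  have hj1 : 0 < j - 1 := by linarith
  have hp : 0 < mj * (j - 1) := mul_pos hmj hj1
  have hq : 0 < δ / (mj * (j - 1)) := div_pos hδ hp
  have hh : 0 < hjδ := by rw [hhj]; exact Real.rpow_pos_of_pos hq _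
  have hpow : hjδ ^ j = δ / (mj * (j - 1)) := by
    rw [hhj, ← Real.rpow_mul hq.le, one_div_mul_cancel hj0.ne', Real.rpow_one]
  have hpow1 : hjδ ^ (j - 1) = δ ^ ((j - 1) / j) / (mj ^ ((j - 1) / j) * (j - 1) ^ ((j - 1) / j)) := by
    rw [hhj, ← Real.rpow_mul hq.le, one_div_mul_eq_div, Real.div_rpow hδ.le hp.le,
      Real.mul_rpow hmj.le hj1.le]
  have hsplit : hjδ ^ j = hjδ ^ (j - 1) * hjδ := by
    rw [Real.rpow_sub_one hh.ne', div_mul_cancel₀ _ hh.ne']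
  have hδh : δ / hjδ = mj * (j - 1) * hjδ ^ (j - 1) := by
    rw [hsplit] at hpow
    rw [eq_div_iff hp.ne'] at hpow
    rw [div_eq_iff hh.ne']
    linarith
  have hm : mj ^ (1 / j) * mj ^ ((j - 1) / j) = mj := by
    rw [← Real.rpow_add hmj]
    have : 1 / j + (j - 1) / j = 1 := by field_simp; ring
    rw [this, Real.rpow_one]
  have hrhs : cj * δ ^ ((j - 1) / j) = δ / hjδ + mj * hjδ ^ (j - 1) := by
    have e : δ / hjδ + mj * hjδ ^ (j - 1) = j * mj * hjδ ^ (j - 1) := by rw [hδh]; ring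
    have h1 := Real.rpow_pos_of_pos hmj ((j - 1) / j)
    have h2 := Real.rpow_pos_of_pos hj1 ((j - 1) / j)
    rw [e, hpow1, hcj, Real.rpow_neg hj1.le, eq_comm]
    nth_rewrite 1 [← hm]
    generalize mj ^ ((j - 1) / j) = A at *
    generalize (j - 1) ^ ((j - 1) / j) = B at *
    generalize δ ^ ((j - 1) / j) = D at *
    generalize mj ^ (1 / j) = E at *
    have h1' := h1.ne'
    have h2' := h2.ne'
    field_simp
  obtain ⟨ξ, ⟨hξ1, hξ2⟩, hξ⟩ := exists_deriv_eq_slope f (show x - hjδ < x + hjδ by linarith)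
    hf.continuous.continuousOn hf.differentiableOn
  have h2h : x + hjδ - (x - hjδ) = 2 * hjδ := by ring
  rw [h2h] at hξ
  have hb : |deriv f ξ - deriv f x| ≤ mj * hjδ ^ (j - 1) := by
    refine (hfholder ξ x).trans ?_
    have : |ξ - x| ≤ hjδ := abs_le.2 ⟨by linarith, by linarith⟩
    gcongr
  have ha : |(fδ (x + hjδ) - fδ (x - hjδ)) / (2 * hjδ) - deriv f ξ| ≤ δ / hjδ := by
    rw [hξ, ← sub_div, abs_div, abs_of_pos (show 0 < 2 * hjδ by linarith),
      div_le_div_iff₀ (by linarith) hh]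
    have a1 := abs_le.1 (hfδ (x + hjδ))
    have a2 := abs_le.1 (hfδ (x - hjδ))
    have : |fδ (x + hjδ) - fδ (x - hjδ) - (f (x + hjδ) - f (x - hjδ))| ≤ 2 * δ :=
      abs_le.2 ⟨by linarith [a1.1, a2.2], by linarith [a1.2, a2.1]⟩
    nlinarith
  rw [hrhs]
  exact (abs_sub_le _ (deriv f ξ) _).trans (add_le_add ha hb)
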